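/- arXiv:0909.0609 — 5 statements merged into one kernel-verified Lean document; each statement's English description precedes it below -/
import Mathlib

section
/- Assume (SP), that ι has dense range, (FN1), (FN3a) and (FN3b). Then there exists a map B from U to the bounded linear operators on H, continuous from the X-norm topology on U to the operator-norm topology, such that each B(x) is self-adjoint and d²(𝓛 ∘ ι)(x)(ξ, η) = ⟨B(x)(ι(ξ)), ι(η)⟩_H for all x ∈ U and ξ, η ∈ X; moreover such B is unique. -/
open scoped RealInnerProductSpace

section DenseRange

variable {E H : Type*} [NormedAddCommGroup E] [NormedSpace ℝ E]
  [NormedAddCommGroup H] [InnerProductSpace ℝ H] {e : E →L[ℝ] H}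

/-- A bounded operator is determined by its matrix elements along a map of dense range. -/
theorem DenseRange.clm_ext_inner (he : DenseRange e) {S T : H →L[ℝ] H}
    (h : ∀ ξ η, ⟪S (e ξ), e η⟫ = ⟪T (e ξ), e η⟫) : S = T :=
  ContinuousLinearMap.coeFn_injective <|
    he.equalizer S.continuous T.continuous <| funext fun ξ =>
      he.eq_of_inner_left ℝ (h ξ)

/-- A bound on the matrix elements along a map of dense range bounds the operator norm. -/
theorem DenseRange.opNorm_le_of_abs_inner_le (he : DenseRange e) {T : H →L[ℝ] H} {C : ℝ}
    (hC : 0 ≤ C) (h : ∀ ξ η, |⟪T (e ξ), e η⟫| ≤ C * ‖e ξ‖ * ‖e η‖) : ‖T‖ ≤ C := by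
  refine ContinuousLinearMap.opNorm_le_of_re_inner_le (𝕜 := ℝ) hC fun x y hx hy => ?_
  have key : |⟪T x, y⟫| ≤ C * ‖x‖ * ‖y‖ :=
    he.induction_on₂ (p := fun x y => |⟪T x, y⟫| ≤ C * ‖x‖ * ‖y‖)
      (isClosed_le (by fun_prop) (by fun_prop)) h x y
  simpa [hx, hy] using (le_abs_self _).trans key

/-- An operator with symmetric matrix elements along a map of dense range is self-adjoint. -/
theorem DenseRange.isSelfAdjoint_of_inner_comm [CompleteSpace H] (he : DenseRange e)
    {T : H →L[ℝ] H} (h : ∀ ξ η, ⟪T (e ξ), e η⟫ = ⟪T (e η), e ξ⟫) : IsSelfAdjoint T := by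
  rw [ContinuousLinearMap.isSelfAdjoint_iff']
  refine he.clm_ext_inner fun ξ η => ?_
  rw [ContinuousLinearMap.adjoint_inner_left, real_inner_comm, h]

/-- A bilinear form which is bounded with respect to the norm induced by a map of dense range
into a Hilbert space is represented by a bounded operator on that Hilbert space. -/
theorem DenseRange.exists_clm_inner_eq [CompleteSpace H] (he : DenseRange e)
    (b : E →ₗ[ℝ] E →ₗ[ℝ] ℝ) {C : ℝ} (hC : 0 ≤ C)
    (hb : ∀ ξ η, |b ξ η| ≤ C * ‖e ξ‖ * ‖e η‖) :
    ∃ T : H →L[ℝ] H, ∀ ξ η, b ξ η = ⟪T (e ξ), e η⟫ := by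
  have riesz (ξ : E) : ∃ v : H, (∀ η, ⟪v, e η⟫ = b ξ η) ∧ ‖v‖ ≤ C * ‖e ξ‖ := by
    refine ⟨(InnerProductSpace.toDual ℝ H).symm ((b ξ).extendOfNorm e.toLinearMap),
      fun η => ?_, ?_⟩
    · rw [InnerProductSpace.toDual_symm_apply]
      exact LinearMap.extendOfNorm_eq he ⟨_, hb ξ⟩ η
    · rw [LinearIsometryEquiv.norm_map]
      exact LinearMap.opNorm_extendOfNorm_le he (by positivity) (hb ξ)
  choose v hv hv_norm using riesz
  let V : E →ₗ[ℝ] H :=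
    { toFun := v
      map_add' := fun ξ₁ ξ₂ => he.eq_of_inner_left ℝ fun η => by simp [inner_add_left, hv]
      map_smul' := fun c ξ => he.eq_of_inner_left ℝ fun η => by
        simp [real_inner_smul_left, hv] }
  refine ⟨V.extendOfNorm e.toLinearMap, fun ξ η => ?_⟩
  have hV : V.extendOfNorm e.toLinearMap (e ξ) = v ξ :=
    LinearMap.extendOfNorm_eq he ⟨C, hv_norm⟩ ξ
  rw [hV, hv]

end DenseRange

/-- Assume (SP), that `ι` has dense range, (FN1), (FN3a) and (FN3b).  Then there is a
map `B` from `U = ι⁻¹(W)` to the bounded self-adjoint operators on `H`, continuous from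
the `X`-norm topology to the operator-norm topology, representing the second differential
of `𝓛 ∘ ι`:  `d²(𝓛 ∘ ι)(x)(ξ, η) = ⟪B x (ι ξ), ι η⟫`; moreover such a `B` is unique
(any two such maps agree on `U`). -/
theorem exists_unique_repr_second_differential
    {X : Type*} [NormedAddCommGroup X] [NormedSpace ℝ X]
    {H : Type*} [NormedAddCommGroup H] [InnerProductSpace ℝ H] [CompleteSpace H]
    (ι : X →L[ℝ] H) (hinj : Function.Injective ι) (hdense : DenseRange (ι : X → H))
    (W : Set H) (hWopen : IsOpen W) (hW0 : (0 : H) ∈ W)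
    (𝓛 : H → ℝ)
    -- (FN1)
    (hFN1 : ContDiffOn ℝ 2 (fun x : X => 𝓛 (ι x)) (ι ⁻¹' W))
    -- (FN3a)
    (hFN3a : ∀ x ∈ ι ⁻¹' W, ∃ C > 0, ∀ ξ η : X,
      |fderiv ℝ (fderiv ℝ (fun y : X => 𝓛 (ι y))) x ξ η| ≤ C * ‖ι ξ‖ * ‖ι η‖)
    -- (FN3b)
    (hFN3b : ∀ ε > 0, ∃ δ > 0, ∀ x₁ ∈ ι ⁻¹' W, ∀ x₂ ∈ ι ⁻¹' W, ‖x₁ - x₂‖ < δ →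
      ∀ ξ η : X,
        |fderiv ℝ (fderiv ℝ (fun y : X => 𝓛 (ι y))) x₁ ξ η -
          fderiv ℝ (fderiv ℝ (fun y : X => 𝓛 (ι y))) x₂ ξ η| ≤ ε * ‖ι ξ‖ * ‖ι η‖) :
    (∃ B : X → H →L[ℝ] H,
      ContinuousOn B (ι ⁻¹' W) ∧
      (∀ x ∈ ι ⁻¹' W, IsSelfAdjoint (B x)) ∧
      (∀ x ∈ ι ⁻¹' W, ∀ ξ η : X,
        fderiv ℝ (fderiv ℝ (fun y : X => 𝓛 (ι y))) x ξ η = ⟪B x (ι ξ), ι η⟫)) ∧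
    ∀ B₁ B₂ : X → H →L[ℝ] H,
      (ContinuousOn B₁ (ι ⁻¹' W) ∧
        (∀ x ∈ ι ⁻¹' W, IsSelfAdjoint (B₁ x)) ∧
        (∀ x ∈ ι ⁻¹' W, ∀ ξ η : X,
          fderiv ℝ (fderiv ℝ (fun y : X => 𝓛 (ι y))) x ξ η = ⟪B₁ x (ι ξ), ι η⟫)) →
      (ContinuousOn B₂ (ι ⁻¹' W) ∧
        (∀ x ∈ ι ⁻¹' W, IsSelfAdjoint (B₂ x)) ∧
        (∀ x ∈ ι ⁻¹' W, ∀ ξ η : X,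
          fderiv ℝ (fderiv ℝ (fun y : X => 𝓛 (ι y))) x ξ η = ⟪B₂ x (ι ξ), ι η⟫)) →
      ∀ x ∈ ι ⁻¹' W, B₁ x = B₂ x := by
  have hUopen : IsOpen (ι ⁻¹' W) := hWopen.preimage ι.continuous
  refine ⟨?_, fun B₁ B₂ h₁ h₂ x hx => hdense.clm_ext_inner fun ξ η =>
    (h₁.2.2 x hx ξ η).symm.trans (h₂.2.2 x hx ξ η)⟩
  have hrepr (x : X) : ∃ T : H →L[ℝ] H, x ∈ ι ⁻¹' W → ∀ ξ η : X,
      fderiv ℝ (fderiv ℝ (fun y : X => 𝓛 (ι y))) x ξ η = ⟪T (ι ξ), ι η⟫ := by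
    by_cases hx : x ∈ ι ⁻¹' W
    · obtain ⟨C, hC, hbound⟩ := hFN3a x hx
      obtain ⟨T, hT⟩ := hdense.exists_clm_inner_eq
        (fderiv ℝ (fderiv ℝ (fun y : X => 𝓛 (ι y))) x).toLinearMap₁₂ hC.le hbound
      exact ⟨T, fun _ => hT⟩
    · exact ⟨0, fun h => absurd h hx⟩
  choose B hB using hrepr
  refine ⟨B, ?_, fun x hx => ?_, hB⟩
  · refine Metric.continuousOn_iff.2 fun x hx ε hε => ?_
    obtain ⟨δ, hδ, h⟩ := hFN3b (ε / 2) (half_pos hε)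
    refine ⟨δ, hδ, fun y hy hyx => ?_⟩
    rw [dist_eq_norm] at hyx ⊢
    refine (hdense.opNorm_le_of_abs_inner_le (half_pos hε).le fun ξ η => ?_).trans_lt
      (half_lt_self hε)
    simpa [inner_sub_left, hB y hy, hB x hx] using h y hy x hx hyx ξ η
  · have hsymm : IsSymmSndFDerivAt ℝ (fun y : X => 𝓛 (ι y)) x :=
      (hFN1.contDiffAt (hUopen.mem_nhds hx)).isSymmSndFDerivAt (by simp)
    refine hdense.isSelfAdjoint_of_inner_comm fun ξ η => ?_
    rw [← hB x hx, ← hB x hx, hsymm.eq]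
end

section
/- Assume (SP), that ι has dense range, (FN1), (FN2) and (FN3). Then for every x ∈ U and every ξ ∈ X one has ι((dA(x))(ξ)) = B(x)(ι(ξ)), where dA(x) : X → X is the Fréchet derivative of A at x; in particular B(x) maps the subspace ι(X) of H into ι(X) for every x ∈ U. -/
open scoped RealInnerProductSpace

/-- Assume (SP), that `ι` has dense range, (FN1), (FN2) and (FN3).  Then for every
`x ∈ U = ι⁻¹(W)` and every `ξ ∈ X` one has `ι (dA(x) ξ) = B x (ι ξ)`; in particular
`B x` maps the subspace `ι(X)` of `H` into `ι(X)` for every `x ∈ U`. -/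
theorem fderiv_A_eq_B_and_B_maps_range
    {X : Type*} [NormedAddCommGroup X] [NormedSpace ℝ X]
    {H : Type*} [NormedAddCommGroup H] [InnerProductSpace ℝ H] [CompleteSpace H]
    (ι : X →L[ℝ] H) (hinj : Function.Injective ι) (hdense : DenseRange (ι : X → H))
    (W : Set H) (hWopen : IsOpen W) (hW0 : (0 : H) ∈ W)
    (𝓛 : H → ℝ)
    -- (FN1)
    (hFN1 : ContDiffOn ℝ 2 (fun x : X => 𝓛 (ι x)) (ι ⁻¹' W))
    -- (FN2)
    (A : X → X)
    (hA1 : ContDiffOn ℝ 1 A (ι ⁻¹' W))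
    (hA : ∀ x ∈ ι ⁻¹' W, ∀ ξ : X,
      fderiv ℝ (fun y : X => 𝓛 (ι y)) x ξ = ⟪ι (A x), ι ξ⟫)
    -- (FN3)
    (B : X → H →L[ℝ] H)
    (hBsa : ∀ x ∈ ι ⁻¹' W, IsSelfAdjoint (B x))
    (hBcont : ContinuousOn B (ι ⁻¹' W))
    (hB : ∀ x ∈ ι ⁻¹' W, ∀ ξ η : X,
      fderiv ℝ (fderiv ℝ (fun y : X => 𝓛 (ι y))) x ξ η = ⟪B x (ι ξ), ι η⟫) :
    (∀ x ∈ ι ⁻¹' W, ∀ ξ : X, ι (fderiv ℝ A x ξ) = B x (ι ξ)) ∧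
    ∀ x ∈ ι ⁻¹' W, ∀ v ∈ Set.range (ι : X → H), B x v ∈ Set.range (ι : X → H) := by
  have hU : IsOpen (ι ⁻¹' W) := hWopen.preimage ι.continuous
  have key : ∀ x ∈ ι ⁻¹' W, ∀ ξ : X, ι (fderiv ℝ A x ξ) = B x (ι ξ) := by
    intro x hx ξ
    have hxU : ι ⁻¹' W ∈ nhds x := hU.mem_nhds hx
    have hAx : HasFDerivAt A (fderiv ℝ A x) x :=
      ((hA1.contDiffAt hxU).differentiableAt one_ne_zero).hasFDerivAt
    have hfx := ((hFN1.contDiffAt hxU).fderiv_right (m := 1) (by norm_num)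
      |>.differentiableAt one_ne_zero).hasFDerivAt
    have hinner (η : X) : ⟪ι η, ι (fderiv ℝ A x ξ)⟫ = ⟪ι η, B x (ι ξ)⟫ := by
      have hgrad := ((innerSL ℝ (ι η)).comp ι).hasFDerivAt.comp x hAx
      have heval := hfx.clm_apply (hasFDerivAt_const η x)
      have heq : (fun y => fderiv ℝ (fun z : X => 𝓛 (ι z)) y η) =ᶠ[nhds x]
          ((innerSL ℝ (ι η)).comp ι) ∘ A := by
        filter_upwards [hxU] with y hy
        simpa [real_inner_comm] using hA y hy η
      have h := DFunLike.congr_fun (hgrad.unique (heval.congr_of_eventuallyEq heq.symm)) ξ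
      simpa [hB x hx, real_inner_comm] using h
    refine ext_inner_left ℝ fun v => ?_
    exact congrFun (hdense.equalizer (g := fun w => ⟪w, ι (fderiv ℝ A x ξ)⟫)
      (h := fun w => ⟪w, B x (ι ξ)⟫) (by fun_prop) (by fun_prop) (funext hinner)) v
  refine ⟨key, ?_⟩
  rintro x hx _ ⟨ξ, rfl⟩
  exact ⟨fderiv ℝ A x ξ, key x hx ξ⟩
end

section
/- Let n ≥ 1 be an integer, T > 0, and let P̂, Q̂, R̂ : ℝ → M_n(ℝ) be continuous T-periodic matrix-valued functions such that each P̂(t) is symmetric and there is c > 0 with ⟨P̂(t)v, v⟩ ≥ c·|v|² for all t ∈ ℝ and v ∈ ℝⁿ. Then there exist M > 0 and δ > 0 such that for every continuously differentiable T-periodic function ξ : ℝ → ℝⁿ one has ∫_0^T ( ⟨P̂(t)ξ'(t), ξ'(t)⟩ + 2⟨Q̂(t)ξ(t), ξ'(t)⟩ + ⟨R̂(t)ξ(t), ξ(t)⟩ ) dt + M·∫_0^T |ξ(t)|² dt ≥ δ·∫_0^T ( |ξ(t)|² + |ξ'(t)|² ) dt. -/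
open MeasureTheory

/-- Young's inequality for the bilinear form of a matrix with bounded entries. -/
lemma two_mul_sum_mulVec_mul_ge {n : ℕ} (A : Matrix (Fin n) (Fin n) ℝ) {K ε : ℝ} (hε : 0 < ε)
    (hA : ∀ i j, |A i j| ≤ K) (v w : Fin n → ℝ) :
    -(n * (K ^ 2 / ε) * ∑ i, v i * v i + n * ε * ∑ i, w i * w i) ≤
      2 * ∑ i, A.mulVec v i * w i := by
  have young (i j : Fin n) :
      -(K ^ 2 / ε * (v j * v j) + ε * (w i * w i)) ≤ 2 * (A i j * v j * w i) := by
    have hsq : A i j ^ 2 ≤ K ^ 2 := sq_le_sq.2 ((hA i j).trans (le_abs_self K))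
    have hdiv : A i j ^ 2 / ε * (v j * v j) ≤ K ^ 2 / ε * (v j * v j) := by
      have := mul_self_nonneg (v j)
      gcongr
    have hcompl : A i j ^ 2 / ε * (v j * v j) + 2 * (A i j * v j * w i) + ε * (w i * w i) =
        (A i j * v j + ε * w i) ^ 2 / ε := by
      field_simp
      ring
    have : 0 ≤ (A i j * v j + ε * w i) ^ 2 / ε := by positivity
    linarith
  calc
    _ = ∑ i, ∑ j, -(K ^ 2 / ε * (v j * v j) + ε * (w i * w i)) := by
      simp only [Finset.sum_neg_distrib, Finset.sum_add_distrib, ← Finset.mul_sum,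
        Finset.sum_const, Finset.card_univ, Fintype.card_fin, nsmul_eq_mul]
      simp only [mul_left_comm _ (n : ℝ), ← Finset.mul_sum]
      ring
    _ ≤ ∑ i, ∑ j, 2 * (A i j * v j * w i) :=
      Finset.sum_le_sum fun i _ => Finset.sum_le_sum fun j _ => young i j
    _ = 2 * ∑ i, A.mulVec v i * w i := by
      simp only [← Finset.mul_sum, ← Finset.sum_mul, Matrix.mulVec, dotProduct]

/-- The entries of a continuous matrix-valued function are uniformly bounded on compact sets. -/
lemma IsCompact.exists_forall_abs_entry_le {n : ℕ} {s : Set ℝ} (hs : IsCompact s)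
    {A : ℝ → Matrix (Fin n) (Fin n) ℝ} (hA : Continuous A) :
    ∃ K, ∀ t ∈ s, ∀ i j, |A t i j| ≤ K := by
  obtain ⟨K, hK⟩ := hs.exists_bound_of_continuousOn
    (f := fun t => (fun i j => A t i j : Fin n → Fin n → ℝ)) (by fun_prop)
  exact ⟨K, fun t ht i j => (norm_le_pi_norm _ j).trans ((norm_le_pi_norm _ i).trans (hK t ht))⟩

/-- Gårding-type inequality: for continuous `T`-periodic matrix coefficients `P̂, Q̂, R̂`
with `P̂(t)` symmetric and uniformly positive definite, there are `M > 0` and `δ > 0`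
such that for every `C¹` `T`-periodic `ξ`,
`∫_0^T (⟨P̂ξ', ξ'⟩ + 2⟨Q̂ξ, ξ'⟩ + ⟨R̂ξ, ξ⟩) + M ∫_0^T |ξ|² ≥ δ ∫_0^T (|ξ|² + |ξ'|²)`. -/
theorem garding_inequality_periodic
    (n : ℕ) (hn : 1 ≤ n) (T : ℝ) (hT : 0 < T)
    (P Q R : ℝ → Matrix (Fin n) (Fin n) ℝ)
    (hPc : Continuous P) (hQc : Continuous Q) (hRc : Continuous R)
    (hPper : ∀ t : ℝ, P (t + T) = P t)
    (hQper : ∀ t : ℝ, Q (t + T) = Q t)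
    (hRper : ∀ t : ℝ, R (t + T) = R t)
    (hPsymm : ∀ t : ℝ, (P t).IsSymm)
    (c : ℝ) (hc : 0 < c)
    (hPpos : ∀ (t : ℝ) (v : Fin n → ℝ),
      c * ∑ i, v i * v i ≤ ∑ i, (P t).mulVec v i * v i) :
    ∃ M > 0, ∃ δ > 0, ∀ ξ : ℝ → Fin n → ℝ, ContDiff ℝ 1 ξ → Function.Periodic ξ T →
      δ * ∫ t in (0 : ℝ)..T,
          ((∑ i, ξ t i * ξ t i) + ∑ i, deriv ξ t i * deriv ξ t i) ≤
      (∫ t in (0 : ℝ)..T,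
          ((∑ i, (P t).mulVec (deriv ξ t) i * deriv ξ t i) +
            2 * (∑ i, (Q t).mulVec (ξ t) i * deriv ξ t i) +
            ∑ i, (R t).mulVec (ξ t) i * ξ t i)) +
        M * ∫ t in (0 : ℝ)..T, ∑ i, ξ t i * ξ t i := by
  obtain ⟨K, hK⟩ := (isCompact_Icc (a := 0) (b := T)).exists_forall_abs_entry_le hQc
  obtain ⟨L, hL⟩ := (isCompact_Icc (a := 0) (b := T)).exists_forall_abs_entry_le hRc
  have hn' : (0 : ℝ) < n := by exact_mod_cast hn
  have hε : 0 < c / (2 * n) := by positivity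
  refine ⟨c / 2 + n * (K ^ 2 / (c / (2 * n))) + (n * (L ^ 2 / 1) + n * 1) / 2, by positivity,
    c / 2, by positivity, fun ξ hξ _ => ?_⟩
  have hξc : Continuous ξ := hξ.continuous
  have hdξc : Continuous (deriv ξ) := hξ.continuous_deriv le_rfl
  rw [← intervalIntegral.integral_const_mul, ← intervalIntegral.integral_const_mul,
    ← intervalIntegral.integral_add]
  · refine intervalIntegral.integral_mono_on hT.le ?_ ?_ fun t ht => ?_
    · exact Continuous.intervalIntegrable (by fun_prop) _ _
    · exact Continuous.intervalIntegrable (by fun_prop) _ _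
    · have hPt := hPpos t (deriv ξ t)
      have hQt := two_mul_sum_mulVec_mul_ge (Q t) hε (hK t ht) (ξ t) (deriv ξ t)
      have hRt := two_mul_sum_mulVec_mul_ge (R t) one_pos (hL t ht) (ξ t) (ξ t)
      have hcancel : n * (c / (2 * n)) = c / 2 := by field_simp
      rw [hcancel] at hQt
      linarith
  · exact Continuous.intervalIntegrable (by fun_prop) _ _
  · exact Continuous.intervalIntegrable (by fun_prop) _ _
end

section
/- Let n ≥ 1 be an integer, T > 0, and let P̂, Q̂, R̂ : ℝ → M_n(ℝ) be continuous T-periodic matrix-valued functions with P̂(t) invertible for every t. Let ξ : ℝ → ℝⁿ be continuous and T-periodic, and let g : ℝ → ℝⁿ be measurable, T-periodic, with ∫_0^T |g(t)|² dt < ∞ and ξ(t) = ξ(0) + ∫_0^t g(s) ds for all t ∈ ℝ. Let ζ : ℝ → ℝⁿ be continuously differentiable and T-periodic, and suppose that for every continuously differentiable T-periodic η : ℝ → ℝⁿ one has ∫_0^T ( ⟨P̂(t)g(t) + Q̂(t)ξ(t), η'(t)⟩ + ⟨Q̂(t)ᵀ g(t) + R̂(t)ξ(t), η(t)⟩ )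 dt = ∫_0^T ( ⟨ζ(t), η(t)⟩ + ⟨ζ'(t), η'(t)⟩ ) dt. Then ξ is continuously differentiable (equivalently, g agrees almost everywhere with a continuous T-periodic function, which is the derivative of ξ). -/
open MeasureTheory

/-- The primitive of a periodic function with zero mean is periodic. -/
theorem periodic_intervalIntegral_of_integral_eq_zero {E : Type*} [NormedAddCommGroup E]
    [NormedSpace ℝ E] {f : ℝ → E} {T : ℝ} (hf : Function.Periodic f T)
    (hint : ∀ a b, IntervalIntegrable f volume a b) (h0 : ∫ t in (0 : ℝ)..T, f t = 0) :
    Function.Periodic (fun t => ∫ s in (0 : ℝ)..t, f s) T := by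
  intro t
  have h := hf.intervalIntegral_add_eq t 0
  rw [zero_add, h0] at h
  simp only
  rw [← intervalIntegral.integral_add_adjacent_intervals (hint 0 t) (hint t (t + T)), h, add_zero]

/-- Integration by parts for the primitives of an integrable and of a continuous function. -/
theorem integral_mul_primitive {q ψ : ℝ → ℝ} {a b : ℝ} (hq : IntervalIntegrable q volume a b)
    (hψ : Continuous ψ) :
    ∫ t in a..b, q t * ∫ s in a..t, ψ s =
      (∫ t in a..b, q t) * (∫ t in a..b, ψ t) - ∫ t in a..b, (∫ s in a..t, q s) * ψ t := by
  have hF := hq.absolutelyContinuousOnInterval_intervalIntegral Set.left_mem_uIcc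
  have hG := (hψ.intervalIntegrable (μ := volume) a b)
    |>.absolutelyContinuousOnInterval_intervalIntegral Set.left_mem_uIcc
  have h := hF.integral_mul_deriv_eq_deriv_mul hG
  have hderiv : ∀ t, deriv (fun t => ∫ s in a..t, ψ s) t = ψ t := fun t =>
    hψ.deriv_integral ψ a t
  have hcongr : ∫ t in a..b, deriv (fun t => ∫ s in a..t, q s) t * ∫ s in a..t, ψ s =
      ∫ t in a..b, q t * ∫ s in a..t, ψ s := by
    apply intervalIntegral.integral_congr_ae
    filter_upwards [hq.ae_hasDerivAt_integral] with t ht htm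
    rw [(ht (Set.uIoc_subset_uIcc htm) a Set.left_mem_uIcc).deriv]
  simp only [hderiv, intervalIntegral.integral_same, mul_zero, sub_zero] at h
  rw [hcongr] at h
  linarith

/-- **Du Bois-Reymond lemma**, periodic version: an integrable function orthogonal to all continuous
periodic functions of zero mean is almost everywhere constant on a period. -/
theorem ae_eq_const_of_integral_mul_eq_zero {h : ℝ → ℝ} {T : ℝ} (hT : 0 < T)
    (hh : IntervalIntegrable h volume 0 T)
    (horth : ∀ ψ : ℝ → ℝ, Continuous ψ → Function.Periodic ψ T → ∫ t in (0 : ℝ)..T, ψ t = 0 →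
      ∫ t in (0 : ℝ)..T, h t * ψ t = 0) :
    ∃ c, ∀ᵐ t, t ∈ Set.Ioo 0 T → h t = c := by
  refine ⟨(∫ t in (0 : ℝ)..T, h t) / T, ?_⟩
  set c := (∫ t in (0 : ℝ)..T, h t) / T with hc
  have hhc : IntervalIntegrable (fun t => h t - c) volume 0 T := hh.sub (by simp)
  suffices H : ∀ᵐ t, t ∈ Set.Ioo 0 T → h t - c = 0 by
    filter_upwards [H] with t ht htm using sub_eq_zero.1 (ht htm)
  refine isOpen_Ioo.ae_eq_zero_of_integral_contDiff_smul_eq_zero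
    (((intervalIntegrable_iff_integrableOn_Ioo_of_le hT.le).1 hhc).locallyIntegrableOn) ?_
  intro ψ hψ _ hsupp
  have hzero : ∀ t, t ∉ Set.Ioo 0 T → ψ t = 0 := fun t ht =>
    image_eq_zero_of_notMem_tsupport fun h' => ht (hsupp h')
  have : Fact (0 < T) := ⟨hT⟩
  set ψp : ℝ → ℝ := fun t => AddCircle.liftIco T 0 ψ (t : AddCircle T) with hψp
  have hψpc : Continuous ψp :=
    (AddCircle.liftIco_zero_continuous (by rw [hzero 0 (by simp), hzero T (by simp)])
      hψ.continuous.continuousOn).comp (AddCircle.continuous_mk' T)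
  have hψpper : Function.Periodic ψp T := fun t => by simp [hψp]
  have hψpeq : ∀ t ∈ Set.Icc 0 T, ψp t = ψ t := by
    intro t ht
    have key : ∀ s ∈ Set.Ico 0 T, ψp s = ψ s := fun s hs =>
      AddCircle.liftIco_coe_apply (by simpa using hs)
    rcases ht.2.eq_or_lt with rfl | hlt
    · rw [hψpper.eq, key 0 (by simpa using hT), hzero 0 (by simp), hzero t (by simp)]
    · exact key t ⟨ht.1, hlt⟩
  set m := (∫ t in (0 : ℝ)..T, ψp t) / T with hm
  have hmean : ∫ t in (0 : ℝ)..T, (ψp t - m) = 0 := by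
    rw [intervalIntegral.integral_sub (hψpc.intervalIntegrable _ _) (by simp)]
    simp only [intervalIntegral.integral_const, sub_zero, smul_eq_mul, hm]
    field_simp
    ring
  have h1 := horth (fun t => ψp t - m) (by fun_prop)
    (fun t => by simp only [hψpper t]) hmean
  have hi : IntervalIntegrable (fun t => h t * ψp t) volume 0 T :=
    hh.mul_continuousOn hψpc.continuousOn
  simp only [mul_sub] at h1
  rw [intervalIntegral.integral_sub hi (hh.mul_const m), intervalIntegral.integral_mul_const] at h1
  have h2 : ∫ t, ψ t • (h t - c) = ∫ t in (0 : ℝ)..T, (h t - c) * ψp t := by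
    rw [intervalIntegral.integral_of_le hT.le, ← setIntegral_eq_integral_of_forall_compl_eq_zero
      (s := Set.Ioc 0 T)]
    · refine setIntegral_congr_fun measurableSet_Ioc fun t ht => ?_
      simp only [hψpeq t ⟨ht.1.le, ht.2⟩, smul_eq_mul, mul_comm]
    · intro t ht
      rw [hzero t fun h' => ht ⟨h'.1, h'.2.le⟩, zero_smul]
  rw [h2]
  simp only [sub_mul]
  rw [intervalIntegral.integral_sub hi ((hψpc.intervalIntegrable _ _).const_mul c),
    intervalIntegral.integral_const_mul]
  have h3 : (∫ t in (0 : ℝ)..T, h t) * m = c * ∫ t in (0 : ℝ)..T, ψp t := by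
    rw [hc, hm]; ring
  linarith

/-- If `p φ' + q φ` integrates to zero for all periodic `φ` of class `C¹`, then `q` has zero mean
and `p` equals a primitive of `q`, almost everywhere on a period. -/
theorem ae_eq_primitive_of_integral_eq_zero {p q : ℝ → ℝ} {T : ℝ} (hT : 0 < T)
    (hp : IntervalIntegrable p volume 0 T) (hq : IntervalIntegrable q volume 0 T)
    (hweak : ∀ φ : ℝ → ℝ, ContDiff ℝ 1 φ → Function.Periodic φ T →
      ∫ t in (0 : ℝ)..T, (p t * deriv φ t + q t * φ t) = 0) :
    ∫ t in (0 : ℝ)..T, q t = 0 ∧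
      ∃ c, ∀ᵐ t, t ∈ Set.Ioo 0 T → p t = c + ∫ s in (0 : ℝ)..t, q s := by
  have hq0 : ∫ t in (0 : ℝ)..T, q t = 0 := by
    simpa using hweak (fun _ => 1) contDiff_const fun _ => rfl
  refine ⟨hq0, ?_⟩
  have hF : ContinuousOn (fun t => ∫ s in (0 : ℝ)..t, q s) (Set.uIcc 0 T) :=
    intervalIntegral.continuousOn_primitive_interval' hq Set.left_mem_uIcc
  obtain ⟨c, hc⟩ := ae_eq_const_of_integral_mul_eq_zero
    (h := fun t => p t - ∫ s in (0 : ℝ)..t, q s) hT (hp.sub hF.intervalIntegrable) (by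
      intro ψ hψ hψper hψ0
      have hder : deriv (fun t => ∫ s in (0 : ℝ)..t, ψ s) = ψ :=
        funext fun t => hψ.deriv_integral ψ 0 t
      have hdiff : Differentiable ℝ (fun t => ∫ s in (0 : ℝ)..t, ψ s) := fun t =>
        (hψ.integral_hasStrictDerivAt 0 t).hasDerivAt.differentiableAt
      have hC1 : ContDiff ℝ 1 (fun t => ∫ s in (0 : ℝ)..t, ψ s) :=
        contDiff_one_iff_deriv.2 ⟨hdiff, by rwa [hder]⟩
      have h1 := hweak _ hC1 (periodic_intervalIntegral_of_integral_eq_zero hψper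
        (fun a b => hψ.intervalIntegrable a b) hψ0)
      rw [hder, intervalIntegral.integral_add (hp.mul_continuousOn hψ.continuousOn)
        (hq.mul_continuousOn hC1.continuous.continuousOn), integral_mul_primitive hq hψ, hq0] at h1
      simp only [sub_mul]
      rw [intervalIntegral.integral_sub (hp.mul_continuousOn hψ.continuousOn)
        (hF.intervalIntegrable.mul_continuousOn hψ.continuousOn)]
      linarith)
  refine ⟨c, ?_⟩
  filter_upwards [hc] with t ht htm
  linarith [ht htm]

/-- Multiplication by a continuous matrix preserves interval integrability of the components. -/
theorem IntervalIntegrable.mulVec_apply {n : ℕ} {A : ℝ → Matrix (Fin n) (Fin n) ℝ}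
    {v : ℝ → Fin n → ℝ} {a b : ℝ} (hA : Continuous A)
    (hv : ∀ i, IntervalIntegrable (fun t => v t i) volume a b) (i : Fin n) :
    IntervalIntegrable (fun t => (A t).mulVec (v t) i) volume a b := by
  have h : (fun t => (A t).mulVec (v t) i) = ∑ j, fun t => A t i j * v t j := by
    ext t
    simp [Matrix.mulVec, dotProduct]
  rw [h]
  exact IntervalIntegrable.sum _ fun j _ =>
    (hv j).continuousOn_mul (hA.matrix_elem i j).continuousOn

/-- Regularity: if `ξ` is a continuous `T`-periodic function with `L²` weak derivative
`g`, and the weak Euler–Lagrange-type identity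
`∫_0^T (⟨P̂g + Q̂ξ, η'⟩ + ⟨Q̂ᵀg + R̂ξ, η⟩) = ∫_0^T (⟨ζ, η⟩ + ⟨ζ', η'⟩)` holds for every
`C¹` `T`-periodic `η`, where `ζ` is `C¹` and `T`-periodic and `P̂(t)` is invertible,
then `ξ` is continuously differentiable. -/
theorem weak_solution_regularity
    (n : ℕ) (hn : 1 ≤ n) (T : ℝ) (hT : 0 < T)
    (P Q R : ℝ → Matrix (Fin n) (Fin n) ℝ)
    (hPc : Continuous P) (hQc : Continuous Q) (hRc : Continuous R)
    (hPper : ∀ t : ℝ, P (t + T) = P t)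
    (hQper : ∀ t : ℝ, Q (t + T) = Q t)
    (hRper : ∀ t : ℝ, R (t + T) = R t)
    (hPinv : ∀ t : ℝ, IsUnit (P t))
    (ξ : ℝ → Fin n → ℝ) (hξc : Continuous ξ) (hξper : Function.Periodic ξ T)
    (g : ℝ → Fin n → ℝ) (hgm : Measurable g) (hgper : Function.Periodic g T)
    (hgL2 : IntervalIntegrable (fun t => ∑ i, g t i * g t i) volume 0 T)
    (hξg : ∀ t : ℝ, ξ t = ξ 0 + ∫ s in (0 : ℝ)..t, g s)
    (ζ : ℝ → Fin n → ℝ) (hζ : ContDiff ℝ 1 ζ) (hζper : Function.Periodic ζ T)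
    (hweak : ∀ η : ℝ → Fin n → ℝ, ContDiff ℝ 1 η → Function.Periodic η T →
      (∫ t in (0 : ℝ)..T,
        ((∑ i, ((P t).mulVec (g t) + (Q t).mulVec (ξ t)) i * deriv η t i) +
          ∑ i, ((Q t).transpose.mulVec (g t) + (R t).mulVec (ξ t)) i * η t i)) =
      ∫ t in (0 : ℝ)..T,
        ((∑ i, ζ t i * η t i) + ∑ i, deriv ζ t i * deriv η t i)) :
    ContDiff ℝ 1 ξ := by
  have hcomp : ∀ {v : ℝ → Fin n → ℝ}, Continuous v → ∀ (a b : ℝ) (i : Fin n),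
      IntervalIntegrable (fun t => v t i) volume a b := fun hv a b i =>
    ((continuous_apply i).comp hv).intervalIntegrable a b
  have hζ' : Continuous (deriv ζ) := hζ.continuous_deriv le_rfl
  have hgi : ∀ i, IntervalIntegrable (fun t => g t i) volume 0 T := by
    intro i
    refine IntervalIntegrable.mono_fun' (g := fun t => 1 + ∑ i, g t i * g t i)
      ((by simp : IntervalIntegrable (fun _ : ℝ => (1 : ℝ)) volume 0 T).add hgL2)
      ((measurable_pi_apply i).comp hgm).aestronglyMeasurable (Filter.Eventually.of_forall ?_)
    intro t
    have h1 : g t i * g t i ≤ ∑ i, g t i * g t i :=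
      Finset.single_le_sum (f := fun i => g t i * g t i) (fun j _ => mul_self_nonneg _)
        (Finset.mem_univ i)
    simp only [Real.norm_eq_abs]
    refine abs_le.2 ⟨?_, ?_⟩ <;> nlinarith [mul_self_nonneg (g t i - 1), mul_self_nonneg (g t i + 1)]
  set p : Fin n → ℝ → ℝ := fun i t =>
    ((P t).mulVec (g t) + (Q t).mulVec (ξ t)) i - deriv ζ t i with hp
  set q : Fin n → ℝ → ℝ := fun i t =>
    ((Q t).transpose.mulVec (g t) + (R t).mulVec (ξ t)) i - ζ t i with hq
  have hpi1 : ∀ i, IntervalIntegrable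
      (fun t => ((P t).mulVec (g t) + (Q t).mulVec (ξ t)) i) volume 0 T := fun i =>
    (IntervalIntegrable.mulVec_apply hPc hgi i).add
      (IntervalIntegrable.mulVec_apply hQc (hcomp hξc 0 T) i)
  have hqi1 : ∀ i, IntervalIntegrable
      (fun t => ((Q t).transpose.mulVec (g t) + (R t).mulVec (ξ t)) i) volume 0 T := fun i =>
    (IntervalIntegrable.mulVec_apply hQc.matrix_transpose hgi i).add
      (IntervalIntegrable.mulVec_apply hRc (hcomp hξc 0 T) i)
  have hpi : ∀ i, IntervalIntegrable (p i) volume 0 T := fun i =>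
    (hpi1 i).sub (hcomp hζ' 0 T i)
  have hqi : ∀ i, IntervalIntegrable (q i) volume 0 T := fun i =>
    (hqi1 i).sub (hcomp hζ.continuous 0 T i)
  have hpq : ∀ i, ∫ t in (0 : ℝ)..T, q i t = 0 ∧
      ∃ c, ∀ᵐ t, t ∈ Set.Ioo 0 T → p i t = c + ∫ s in (0 : ℝ)..t, q i s := by
    intro i
    refine ae_eq_primitive_of_integral_eq_zero hT (hpi i) (hqi i) fun φ hφ hφper => ?_
    have hφ' : Continuous (deriv φ) := hφ.continuous_deriv le_rfl
    have h := hweak (fun t => φ t • Pi.single i (1 : ℝ)) (hφ.smul contDiff_const)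
      (fun t => by simp only [hφper t])
    have hd : deriv (fun t => φ t • (Pi.single i (1 : ℝ) : Fin n → ℝ)) =
        fun t => deriv φ t • Pi.single i (1 : ℝ) := funext fun t =>
      deriv_smul_const (hφ.differentiable one_ne_zero t) _
    rw [hd] at h
    simp only [Pi.smul_apply, Pi.single_apply, smul_eq_mul, mul_ite, mul_one, mul_zero,
      Finset.sum_ite_eq', Finset.mem_univ, if_true] at h
    rw [← sub_eq_zero, ← intervalIntegral.integral_sub] at h
    · rw [← h]
      congr 1
      ext t
      simp only [hp, hq]
      ring
    · exact ((hpi1 i).mul_continuousOn hφ'.continuousOn).add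
        ((hqi1 i).mul_continuousOn hφ.continuous.continuousOn)
    · exact ((hcomp hζ.continuous 0 T i).mul_continuousOn hφ.continuous.continuousOn).add
        ((hcomp hζ' 0 T i).mul_continuousOn hφ'.continuousOn)
  choose hq0 c hc using hpq
  have hζ'per : Function.Periodic (deriv ζ) T := fun t => by
    rw [← deriv_comp_add_const, hζper.funext]
  have hqper : ∀ i, Function.Periodic (q i) T := fun i t => by
    simp only [hq, hQper t, hRper t, hgper t, hξper t, hζper t]
  have hqint : ∀ i a b, IntervalIntegrable (q i) volume a b := fun i =>
    (hqper i).intervalIntegrable₀ hT.ne' (hqi i)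
  set F : ℝ → Fin n → ℝ := fun t i => c i + ∫ s in (0 : ℝ)..t, q i s with hF
  have hFc : Continuous F := continuous_pi fun i =>
    continuous_const.add (intervalIntegral.continuous_primitive (hqint i) 0)
  have hFper : Function.Periodic F T := fun t => funext fun i =>
    congrArg (c i + ·) (periodic_intervalIntegral_of_integral_eq_zero (hqper i) (hqint i) (hq0 i) t)
  set G : ℝ → Fin n → ℝ := fun t =>
    (P t)⁻¹.mulVec (F t + deriv ζ t - (Q t).mulVec (ξ t)) with hG
  have hdet : ∀ t, IsUnit (P t).det := fun t => (Matrix.isUnit_iff_isUnit_det _).1 (hPinv t)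
  have hPinvc : Continuous fun t => (P t)⁻¹ := by
    simp only [Matrix.inv_def, Ring.inverse_eq_inv']
    exact (hPc.matrix_det.inv₀ fun t => (hdet t).ne_zero).smul hPc.matrix_adjugate
  have hGc : Continuous G :=
    hPinvc.matrix_mulVec ((hFc.add hζ').sub (hQc.matrix_mulVec hξc))
  have hGper : Function.Periodic G T := fun t => by
    simp only [hG, hPper t, hFper t, hζ'per t, hQper t, hξper t]
  have hgG : ∀ᵐ t, t ∈ Set.Ioo 0 T → g t = G t := by
    filter_upwards [ae_all_iff.2 hc] with t ht htm
    have h : F t + deriv ζ t - (Q t).mulVec (ξ t) = (P t).mulVec (g t) := by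
      ext i
      have := ht i htm
      simp only [hp, Pi.add_apply] at this
      simp only [hF, Pi.sub_apply, Pi.add_apply]
      linarith
    rw [hG]
    simp only [h]
    rw [Matrix.mulVec_mulVec, Matrix.nonsing_inv_mul _ (hdet t), Matrix.one_mulVec]
  have hIcc : ∀ t ∈ Set.Icc 0 T, ∫ s in (0 : ℝ)..t, g s = ∫ s in (0 : ℝ)..t, G s := by
    intro t ht
    apply intervalIntegral.integral_congr_ae
    filter_upwards [hgG, Measure.ae_ne volume T] with s hs hsT hsm
    rw [Set.uIoc_of_le ht.1] at hsm
    exact hs ⟨hsm.1, lt_of_le_of_ne (hsm.2.trans ht.2) hsT⟩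
  have hG0 : ∫ s in (0 : ℝ)..T, G s = 0 := by
    rw [← hIcc T ⟨hT.le, le_rfl⟩]
    have h := hξg T
    rw [hξper.eq] at h
    simpa using h
  have hprim := periodic_intervalIntegral_of_integral_eq_zero hGper
    (fun a b => hGc.intervalIntegrable a b) hG0
  have hξG : ξ = fun t => ξ 0 + ∫ s in (0 : ℝ)..t, G s := by
    have hper : Function.Periodic (fun t => ξ t - ∫ s in (0 : ℝ)..t, G s) T := hξper.sub hprim
    ext1 t
    obtain ⟨s, hs, hst⟩ := hper.exists_mem_Ico₀ hT t
    have h := hξg s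
    rw [hIcc s ⟨hs.1, hs.2.le⟩] at h
    simp only [h, add_sub_cancel_right] at hst
    exact sub_eq_iff_eq_add.1 hst
  have hderiv : ∀ t, HasDerivAt ξ (G t) t := fun t => by
    rw [hξG]
    exact ((hGc.integral_hasStrictDerivAt 0 t).hasDerivAt).const_add _
  exact contDiff_one_iff_deriv.2 ⟨fun t => (hderiv t).differentiableAt, by
    rwa [funext fun t => (hderiv t).deriv]⟩
end

section
/- Let n ≥ 1 be an integer and T > 0. Let L̃ : ℝ × ℝⁿ × ℝⁿ → ℝ be twice continuously differentiable with L̃(t + T, q, v) = L̃(t, q, v) for all (t, q, v), and let γ : ℝ → ℝⁿ be continuously differentiable and T-periodic. Set u(t) := D_v L̃(t, γ(t), γ'(t)), w(t) := D_q L̃(t, γ(t), γ'(t)), ū := (1/T)·∫_0^T u(t) dt, G(s) := ∫_0^s ( u(t) − ū ) dt, and ∇(t) := (1/2)·∫_t^∞ e^{t−s} ( w(s) − G(s) ) ds + (1/2)·∫_{−∞}^t e^{s−t} ( w(s) − G(s) ) ds + G(t). Then G and ∇ are T-periodic, ∇ is continuously differentiable, and for every continuously differentiable T-periodic ξ : ℝ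 → ℝⁿ one has ∫_0^T ( ⟨∇(t), ξ(t)⟩ + ⟨∇'(t), ξ'(t)⟩ ) dt = ∫_0^T ( ⟨w(t), ξ(t)⟩ + ⟨u(t), ξ'(t)⟩ ) dt; that is, ∇ represents the first variation ξ ↦ ∫_0^T ( ⟨D_q L̃(t, γ, γ'), ξ⟩ + ⟨D_v L̃(t, γ, γ'), ξ'⟩ ) dt of the Lagrangian action with respect to the W^{1,2} inner product (ξ, η) ↦ ∫_0^T (⟨ξ, η⟩ + ⟨ξ', η'⟩) dt on T-periodic C¹ functions. -/
open MeasureTheory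

section ExponentialTail

variable {E : Type*} [NormedAddCommGroup E] [NormedSpace ℝ E]

/-- `∫_t^∞ e^{t-s} h(s) ds`. -/
noncomputable def expTail (h : ℝ → E) (t : ℝ) : E :=
  ∫ s in Set.Ici t, Real.exp (t - s) • h s

theorem expTail_eq_exp_smul (h : ℝ → E) (t : ℝ) :
    expTail h t = Real.exp t • ∫ s in Set.Ioi t, Real.exp (-s) • h s := by
  simp only [expTail, integral_Ici_eq_integral_Ioi, sub_eq_add_neg, Real.exp_add, mul_smul]
  exact integral_smul _ _

theorem integrableOn_exp_neg_smul {h : ℝ → E} (hc : Continuous h)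
    (hb : Bornology.IsBounded (Set.range h)) (a : ℝ) :
    IntegrableOn (fun s => Real.exp (-s) • h s) (Set.Ioi a) := by
  obtain ⟨C, hC⟩ := hb.exists_norm_le
  exact (integrableOn_exp_neg_Ioi a).smul_bdd C hc.aestronglyMeasurable
    (.of_forall fun s => hC _ ⟨s, rfl⟩)

theorem hasDerivAt_expTail [CompleteSpace E] {h : ℝ → E} (hc : Continuous h)
    (hb : Bornology.IsBounded (Set.range h)) (t : ℝ) :
    HasDerivAt (expTail h) (expTail h t - h t) t := by
  have hcont : Continuous fun s => Real.exp (-s) • h s := by fun_prop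
  have key : ∀ x, ∫ s in Set.Ioi x, Real.exp (-s) • h s =
      (∫ s in Set.Ioi (0 : ℝ), Real.exp (-s) • h s) -
        ∫ s in (0 : ℝ)..x, Real.exp (-s) • h s := fun x => by
    rw [← intervalIntegral.integral_Ioi_sub_Ioi' (integrableOn_exp_neg_smul hc hb 0)
      (integrableOn_exp_neg_smul hc hb x), sub_sub_cancel]
  have hfun : expTail h = fun x => Real.exp x • ((∫ s in Set.Ioi (0 : ℝ), Real.exp (-s) • h s) -
        ∫ s in (0 : ℝ)..x, Real.exp (-s) • h s) := by
    funext x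
    rw [expTail_eq_exp_smul, key]
  have hd := (Real.hasDerivAt_exp t).fun_smul
    ((hcont.integral_hasStrictDerivAt 0 t).hasDerivAt.const_sub
      (∫ s in Set.Ioi (0 : ℝ), Real.exp (-s) • h s))
  rw [hfun]
  refine hd.congr_deriv ?_
  rw [smul_neg, smul_smul, ← Real.exp_add, add_neg_cancel, Real.exp_zero, one_smul]
  abel

theorem periodic_expTail {h : ℝ → E} {T : ℝ} (hp : Function.Periodic h T) :
    Function.Periodic (expTail h) T := fun t => by
  have := (measurePreserving_add_right volume T).setIntegral_preimage_emb
    (measurableEmbedding_addRight T) (fun s => Real.exp (t + T - s) • h s) (Set.Ici (t + T))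
  simpa [expTail, hp _] using this.symm

theorem integral_Iic_exp_smul_eq_expTail (h : ℝ → E) (t : ℝ) :
    ∫ s in Set.Iic t, Real.exp (s - t) • h s = expTail (fun s => h (-s)) (-t) := by
  rw [expTail, integral_Ici_eq_integral_Ioi, ← integral_comp_neg_Iic]
  simp [neg_add_eq_sub]

/-- `½ ∫_ℝ e^{-|t-s|} h(s) ds`, the bounded solution of the ODE in which the second derivative is `y - h`. -/
noncomputable def greenConv (h : ℝ → E) (t : ℝ) : E :=
  (1 / 2 : ℝ) • expTail h t + (1 / 2 : ℝ) • expTail (fun s => h (-s)) (-t)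

/-- The derivative of `greenConv h`. -/
noncomputable def greenConvDeriv (h : ℝ → E) (t : ℝ) : E :=
  (1 / 2 : ℝ) • expTail h t - (1 / 2 : ℝ) • expTail (fun s => h (-s)) (-t)

theorem hasDerivAt_expTail_neg [CompleteSpace E] {h : ℝ → E} (hc : Continuous h)
    (hb : Bornology.IsBounded (Set.range h)) (t : ℝ) :
    HasDerivAt (fun t => expTail (fun s => h (-s)) (-t))
      (h t - expTail (fun s => h (-s)) (-t)) t := by
  have hb' : Bornology.IsBounded (Set.range fun s => h (-s)) :=
    hb.subset (Set.range_comp_subset_range _ h)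
  have := (hasDerivAt_expTail (hc.comp continuous_neg) hb' (-t)).scomp t (hasDerivAt_neg t)
  exact this.congr_deriv (by simp [Function.comp_def])

theorem hasDerivAt_greenConv [CompleteSpace E] {h : ℝ → E} (hc : Continuous h)
    (hb : Bornology.IsBounded (Set.range h)) (t : ℝ) :
    HasDerivAt (greenConv h) (greenConvDeriv h t) t := by
  refine (((hasDerivAt_expTail hc hb t).const_smul (1 / 2 : ℝ)).add
    ((hasDerivAt_expTail_neg hc hb t).const_smul (1 / 2 : ℝ))).congr_deriv ?_
  rw [greenConvDeriv]
  module

theorem hasDerivAt_greenConvDeriv [CompleteSpace E] {h : ℝ → E} (hc : Continuous h)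
    (hb : Bornology.IsBounded (Set.range h)) (t : ℝ) :
    HasDerivAt (greenConvDeriv h) (greenConv h t - h t) t := by
  refine (((hasDerivAt_expTail hc hb t).const_smul (1 / 2 : ℝ)).sub
    ((hasDerivAt_expTail_neg hc hb t).const_smul (1 / 2 : ℝ))).congr_deriv ?_
  rw [greenConv]
  module

theorem periodic_expTail_neg {h : ℝ → E} {T : ℝ} (hp : Function.Periodic h T) :
    Function.Periodic (fun t => expTail (fun s => h (-s)) (-t)) T := fun t => by
  have hp' : Function.Periodic (fun s => h (-s)) T := fun s => by
    simp only [neg_add', hp.sub_eq]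
  simp only [neg_add', (periodic_expTail hp').sub_eq]

theorem periodic_greenConv {h : ℝ → E} {T : ℝ} (hp : Function.Periodic h T) :
    Function.Periodic (greenConv h) T := fun t => by
  have := periodic_expTail_neg hp t
  simp only at this
  rw [greenConv, greenConv, periodic_expTail hp t, this]

theorem periodic_greenConvDeriv {h : ℝ → E} {T : ℝ} (hp : Function.Periodic h T) :
    Function.Periodic (greenConvDeriv h) T := fun t => by
  have := periodic_expTail_neg hp t
  simp only at this
  rw [greenConvDeriv, greenConvDeriv, periodic_expTail hp t, this]

end ExponentialTail

theorem periodic_deriv {E : Type*} [NormedAddCommGroup E] [NormedSpace ℝ E] {f : ℝ → E} {T : ℝ}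
    (hp : Function.Periodic f T) : Function.Periodic (deriv f) T := fun t => by
  rw [← deriv_comp_add_const, funext hp]

/-- The primitive of a periodic function minus its mean is periodic. -/
theorem periodic_integral_sub_mean {E : Type*} [NormedAddCommGroup E] [NormedSpace ℝ E]
    [CompleteSpace E] {f : ℝ → E} {T : ℝ} (hT : T ≠ 0)
    (hc : Continuous f) (hp : Function.Periodic f T) :
    Function.Periodic
      (fun s => ∫ t in (0 : ℝ)..s, (f t - (1 / T) • ∫ t in (0 : ℝ)..T, f t)) T := fun s => by
  set m := (1 / T) • ∫ t in (0 : ℝ)..T, f t with hm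
  have hp' : Function.Periodic (fun t => f t - m) T := fun t => by simp only [hp t]
  have hint : ∀ a b, IntervalIntegrable (fun t => f t - m) volume a b := fun a b =>
    (hc.sub continuous_const).intervalIntegrable a b
  have hzero : ∫ t in (0 : ℝ)..T, (f t - m) = 0 := by
    rw [intervalIntegral.integral_sub (hc.intervalIntegrable _ _)
      intervalIntegrable_const, intervalIntegral.integral_const, hm, smul_smul, sub_zero,
      mul_one_div_cancel hT, one_smul, sub_self]
  have := hp'.intervalIntegral_add_eq s 0
  rw [zero_add, hzero] at this
  simp only
  rw [← intervalIntegral.integral_add_adjacent_intervals (hint 0 s) (hint s (s + T)), this,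
    add_zero]

section PartialGradients

variable {E F : Type*} [NormedAddCommGroup E] [NormedSpace ℝ E]
  [NormedAddCommGroup F] [NormedSpace ℝ F] {L : ℝ × E × F → ℝ}

theorem fderiv_third_apply (hL : Differentiable ℝ L) (t : ℝ) (q : E) (v e : F) :
    fderiv ℝ (fun v => L (t, q, v)) v e = fderiv ℝ L (t, q, v) (0, 0, e) := by
  have h : HasFDerivAt (fun v : F => (t, q, v))
      ((0 : F →L[ℝ] ℝ).prod ((0 : F →L[ℝ] E).prod (.id ℝ F))) v :=
    (hasFDerivAt_const t v).prodMk ((hasFDerivAt_const q v).prodMk (hasFDerivAt_id v))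
  have hcomp : HasFDerivAt (fun v => L (t, q, v)) _ v :=
    (hL (t, q, v)).hasFDerivAt.comp v h
  rw [hcomp.fderiv]
  simp

theorem fderiv_second_apply (hL : Differentiable ℝ L) (t : ℝ) (q e : E) (v : F) :
    fderiv ℝ (fun q => L (t, q, v)) q e = fderiv ℝ L (t, q, v) (0, e, 0) := by
  have h : HasFDerivAt (fun q : E => (t, q, v))
      ((0 : E →L[ℝ] ℝ).prod ((ContinuousLinearMap.id ℝ E).prod (0 : E →L[ℝ] F))) q :=
    (hasFDerivAt_const t q).prodMk ((hasFDerivAt_id q).prodMk (hasFDerivAt_const v q))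
  have hcomp : HasFDerivAt (fun q => L (t, q, v)) _ q :=
    (hL (t, q, v)).hasFDerivAt.comp q h
  rw [hcomp.fderiv]
  simp

end PartialGradients

/-- The explicit `W^{1,2}`-gradient of the Lagrangian action functional at a `C¹`
`T`-periodic curve `γ`: with `u = D_v L̃(t, γ, γ')`, `w = D_q L̃(t, γ, γ')`,
`ū = (1/T)∫_0^T u`, `G s = ∫_0^s (u - ū)` and
`∇ t = (1/2)∫_t^∞ e^{t-s}(w - G) + (1/2)∫_{-∞}^t e^{s-t}(w - G) + G t`,
the functions `G` and `∇` are `T`-periodic, `∇` is `C¹`, and `∇` represents the first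
variation `ξ ↦ ∫_0^T (⟨w, ξ⟩ + ⟨u, ξ'⟩)` with respect to the `W^{1,2}` inner product. -/
theorem gradient_of_lagrangian_action
    (n : ℕ) (hn : 1 ≤ n) (T : ℝ) (hT : 0 < T)
    (L : ℝ × (Fin n → ℝ) × (Fin n → ℝ) → ℝ) (hL : ContDiff ℝ 2 L)
    (hLper : ∀ (t : ℝ) (q v : Fin n → ℝ), L (t + T, q, v) = L (t, q, v))
    (γ : ℝ → Fin n → ℝ) (hγ : ContDiff ℝ 1 γ) (hγper : Function.Periodic γ T)
    (u w : ℝ → Fin n → ℝ)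
    (hu : ∀ (t : ℝ) (i : Fin n),
      u t i = fderiv ℝ (fun v : Fin n → ℝ => L (t, γ t, v)) (deriv γ t) (Pi.single i 1))
    (hw : ∀ (t : ℝ) (i : Fin n),
      w t i = fderiv ℝ (fun q : Fin n → ℝ => L (t, q, deriv γ t)) (γ t) (Pi.single i 1))
    (ubar : Fin n → ℝ) (hubar : ubar = (1 / T) • ∫ t in (0 : ℝ)..T, u t)
    (G : ℝ → Fin n → ℝ) (hG : ∀ s : ℝ, G s = ∫ t in (0 : ℝ)..s, (u t - ubar))
    (grad : ℝ → Fin n → ℝ)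
    (hgrad : ∀ t : ℝ, grad t =
      (1 / 2 : ℝ) • (∫ s in Set.Ici t, Real.exp (t - s) • (w s - G s)) +
      (1 / 2 : ℝ) • (∫ s in Set.Iic t, Real.exp (s - t) • (w s - G s)) + G t) :
    Function.Periodic G T ∧ Function.Periodic grad T ∧ ContDiff ℝ 1 grad ∧
    ∀ ξ : ℝ → Fin n → ℝ, ContDiff ℝ 1 ξ → Function.Periodic ξ T →
      (∫ t in (0 : ℝ)..T,
        ((∑ i, grad t i * ξ t i) + ∑ i, deriv grad t i * deriv ξ t i)) =
      ∫ t in (0 : ℝ)..T,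
        ((∑ i, w t i * ξ t i) + ∑ i, u t i * deriv ξ t i) := by
  have hγ' : Continuous (deriv γ) := hγ.continuous_deriv le_rfl
  have hγ'per := periodic_deriv hγper
  have hLd : Differentiable ℝ L := hL.differentiable (by norm_num)
  have hL' : Continuous (fderiv ℝ L) := hL.continuous_fderiv (by norm_num)
  have huc : Continuous u := by
    refine continuous_pi fun i => ?_
    simp only [hu, fderiv_third_apply hLd]
    have := hγ.continuous
    fun_prop
  have hwc : Continuous w := by
    refine continuous_pi fun i => ?_
    simp only [hw, fderiv_second_apply hLd]
    have := hγ.continuous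
    fun_prop
  have hup : Function.Periodic u T := fun t => by
    ext i
    simp only [hu, hLper, hγper t, hγ'per t]
  have hwp : Function.Periodic w T := fun t => by
    ext i
    simp only [hw, hLper, hγper t, hγ'per t]
  have hGp : Function.Periodic G T := by
    rw [funext hG, hubar]
    exact periodic_integral_sub_mean hT.ne' huc hup
  have hGd : ∀ t, HasDerivAt G (u t - ubar) t := fun t => by
    rw [funext hG]
    exact ((huc.sub continuous_const).integral_hasStrictDerivAt 0 t).hasDerivAt
  have hGc : Continuous G := continuous_iff_continuousAt.2 fun t => (hGd t).continuousAt
  set h : ℝ → Fin n → ℝ := fun s => w s - G s with hh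
  have hc : Continuous h := hwc.sub hGc
  have hp : Function.Periodic h T := hwp.sub hGp
  have hb := hp.isBounded_of_continuous hT.ne' hc
  have hgradeq : grad = greenConv h + G := by
    ext1 t
    rw [hgrad, integral_Iic_exp_smul_eq_expTail h t]
    rfl
  have hgradd : ∀ t, HasDerivAt grad (greenConvDeriv h t + (u t - ubar)) t := fun t => by
    rw [hgradeq]
    exact (hasDerivAt_greenConv hc hb t).add (hGd t)
  have hderiv : deriv grad = fun t => greenConvDeriv h t + (u t - ubar) :=
    funext fun t => (hgradd t).deriv
  have hDc : Continuous (greenConvDeriv h) :=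
    continuous_iff_continuousAt.2 fun t => (hasDerivAt_greenConvDeriv hc hb t).continuousAt
  have hdc : Continuous (deriv grad) := hderiv ▸ hDc.add (huc.sub continuous_const)
  have hC1 : ContDiff ℝ 1 grad :=
    contDiff_one_iff_deriv.2 ⟨fun t => (hgradd t).differentiableAt, hdc⟩
  refine ⟨hGp, hgradeq ▸ (periodic_greenConv hp).add hGp, hC1, fun ξ hξ hξp => ?_⟩
  have hgc := hC1.continuous
  have hξc := hξ.continuous
  have hξ' : Continuous (deriv ξ) := hξ.continuous_deriv le_rfl
  have hP : ∀ t, HasDerivAt (fun t => ∑ i, (greenConvDeriv h t i - ubar i) * ξ t i)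
      (((∑ i, grad t i * ξ t i) + ∑ i, deriv grad t i * deriv ξ t i) -
        ((∑ i, w t i * ξ t i) + ∑ i, u t i * deriv ξ t i)) t := fun t => by
    have hξd := hasDerivAt_pi.1 (hξ.differentiable one_ne_zero t).hasDerivAt
    have hDd := hasDerivAt_pi.1 (hasDerivAt_greenConvDeriv hc hb t)
    refine (HasDerivAt.fun_sum (u := Finset.univ)
      fun i _ => ((hDd i).sub_const (ubar i)).fun_mul (hξd i)).congr_deriv ?_
    simp only [← Finset.sum_add_distrib, ← Finset.sum_sub_distrib]
    refine Finset.sum_congr rfl fun i _ => ?_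
    rw [hderiv]
    simp only [hgradeq, hh, Pi.add_apply, Pi.sub_apply]
    ring
  have hcl : Continuous fun t => (∑ i, grad t i * ξ t i) + ∑ i, deriv grad t i * deriv ξ t i := by
    fun_prop
  have hcr : Continuous fun t => (∑ i, w t i * ξ t i) + ∑ i, u t i * deriv ξ t i := by
    fun_prop
  rw [← sub_eq_zero, ← intervalIntegral.integral_sub (hcl.intervalIntegrable _ _)
    (hcr.intervalIntegrable _ _), intervalIntegral.integral_eq_sub_of_hasDerivAt
    (fun t _ => hP t) ((hcl.sub hcr).intervalIntegrable _ _)]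
  simp only [(periodic_greenConvDeriv hp).eq, hξp.eq, sub_self]
end
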